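/- arXiv:1409.6936 — 2 statements merged into one kernel-verified Lean document; each statement's English description precedes it below -/
import Mathlib

section
/- Let (H, α) be a monoidal Hom-Hopf T-coalgebra over G with bijective antipode, (M, μ) a p-Yetter–Drinfeld module and (N, ν) a q-Yetter–Drinfeld module over (H, α). Set ^MN = ^pN ∈ YD_{pqp^{-1}} and define c_{M,N}: M ⊗ N → ^MN ⊗ M by c_{M,N}(m ⊗ n) = ^p(S_{q^{-1}}(m_{(1,q^{-1})})·ν^{-1}(n)) ⊗ μ(m_{(0)}). Then c_{M,N} is H-colinear: for every r ∈ G, ρ^{^MN ⊗ M}_r ∘ c_{M,N} = (c_{M,N} ⊗ id_{H_r}) ∘ ρ^{M⊗N}_r, where both sides use the tensor-product coactions. -/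
open TensorProduct

noncomputable section

section Cast

variable (k : Type*) [Field k] {G : Type*} [Group G] {H : G → Type*}
  [∀ p, AddCommGroup (H p)] [∀ p, Module k (H p)]

/-- Transport of components along an equality of group elements. -/
def cst {a b : G} (h : a = b) : H a →ₗ[k] H b := by subst h; exact LinearMap.id

/-- Transport of components along an equality of group elements, as a linear equivalence. -/
def cstE {a b : G} (h : a = b) : H a ≃ₗ[k] H b := by subst h; exact LinearEquiv.refl k (H a)

end Cast

/-- A (classical) Hopf group-coalgebra over a group `G`. -/
structure HopfGC (k : Type*) [Field k] (G : Type*) [Group G] (H : G → Type*)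
    [∀ p, AddCommGroup (H p)] [∀ p, Module k (H p)] where
  mul : ∀ p : G, H p →ₗ[k] H p →ₗ[k] H p
  one : ∀ p : G, H p
  comul : ∀ p q : G, H (p * q) →ₗ[k] H p ⊗[k] H q
  counit : H (1 : G) →ₗ[k] k
  antipode : ∀ p : G, H p →ₗ[k] H p⁻¹
  mul_assoc' : ∀ (p : G) (a b c : H p), mul p (mul p a b) c = mul p a (mul p b c)
  one_mul' : ∀ (p : G) (a : H p), mul p (one p) a = a
  mul_one' : ∀ (p : G) (a : H p), mul p a (one p) = a
  coassoc : ∀ p q r : G,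
    (TensorProduct.assoc k (H p) (H q) (H r)).toLinearMap.comp
      ((TensorProduct.map (comul p q) LinearMap.id).comp (comul (p * q) r))
    = (TensorProduct.map LinearMap.id (comul q r)).comp
        ((comul p (q * r)).comp (cst k (mul_assoc p q r)))
  counit_comul' : ∀ (p : G) (c : H p),
    (TensorProduct.lid k (H p))
      ((TensorProduct.map counit LinearMap.id) (comul 1 p (cst k (one_mul p).symm c))) = c
  comul_counit' : ∀ (p : G) (c : H p),
    (TensorProduct.rid k (H p))
      ((TensorProduct.map LinearMap.id counit) (comul p 1 (cst k (mul_one p).symm c))) = c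
  comul_mul : ∀ (p q : G) (a b : H (p * q)),
    comul p q (mul (p * q) a b)
      = TensorProduct.map₂ (mul p) (mul q) (comul p q a) (comul p q b)
  comul_one : ∀ p q : G, comul p q (one (p * q)) = (one p) ⊗ₜ[k] (one q)
  counit_mul : ∀ a b : H (1 : G), counit (mul 1 a b) = counit a * counit b
  counit_one : counit (one 1) = 1
  antipode_left : ∀ (p : G) (h : H (1 : G)),
    TensorProduct.lift (mul p)
      ((TensorProduct.map ((cst k (inv_inv p)).comp (antipode p⁻¹)) LinearMap.id)
        (comul p⁻¹ p (cst k (show (1 : G) = p⁻¹ * p by group) h)))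
    = counit h • one p
  antipode_right : ∀ (p : G) (h : H (1 : G)),
    TensorProduct.lift (mul p)
      ((TensorProduct.map LinearMap.id ((cst k (inv_inv p)).comp (antipode p⁻¹)))
        (comul p p⁻¹ (cst k (show (1 : G) = p * p⁻¹ by group) h)))
    = counit h • one p

/-- An automorphism of a Hopf group-coalgebra. -/
structure HopfGCAut {k : Type*} [Field k] {G : Type*} [Group G] {H : G → Type*}
    [∀ p, AddCommGroup (H p)] [∀ p, Module k (H p)] (D : HopfGC k G H) where
  α : ∀ p : G, H p ≃ₗ[k] H p
  map_mul : ∀ (p : G) (a b : H p), α p (D.mul p a b) = D.mul p (α p a) (α p b)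
  map_one : ∀ p : G, α p (D.one p) = D.one p
  map_comul : ∀ (p q : G) (c : H (p * q)),
    TensorProduct.map (α p).toLinearMap (α q).toLinearMap (D.comul p q c)
      = D.comul p q (α (p * q) c)
  map_counit : ∀ c : H (1 : G), D.counit (α 1 c) = D.counit c
  map_antipode : ∀ (p : G) (h : H p), D.antipode p (α p h) = α p⁻¹ (D.antipode p h)

/-- The axioms of a group-cograded monoidal Hom-Hopf algebra, for given structure data. -/
structure IsGCHH (k : Type*) [Field k] {G : Type*} [Group G] {H : G → Type*}
    [∀ p, AddCommGroup (H p)] [∀ p, Module k (H p)]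
    (mul : ∀ p : G, H p →ₗ[k] H p →ₗ[k] H p) (one : ∀ p : G, H p)
    (comul : ∀ p q : G, H (p * q) →ₗ[k] H p ⊗[k] H q) (counit : H (1 : G) →ₗ[k] k)
    (antipode : ∀ p : G, H p →ₗ[k] H p⁻¹) (α : ∀ p : G, H p ≃ₗ[k] H p) : Prop where
  hom_assoc : ∀ (p : G) (a b c : H p), mul p (α p a) (mul p b c) = mul p (mul p a b) (α p c)
  one_mul' : ∀ (p : G) (a : H p), mul p (one p) a = α p a
  mul_one' : ∀ (p : G) (a : H p), mul p a (one p) = α p a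
  α_mul : ∀ (p : G) (a b : H p), α p (mul p a b) = mul p (α p a) (α p b)
  α_one : ∀ p : G, α p (one p) = one p
  hcoassoc : ∀ p q r : G,
    (TensorProduct.map (α p).symm.toLinearMap (comul q r)).comp
      ((comul p (q * r)).comp (cst k (mul_assoc p q r)))
    = (TensorProduct.assoc k (H p) (H q) (H r)).toLinearMap.comp
        ((TensorProduct.map (comul p q) (α r).symm.toLinearMap).comp (comul (p * q) r))
  counit_comul' : ∀ (p : G) (c : H p),
    (TensorProduct.lid k (H p))
      ((TensorProduct.map counit LinearMap.id) (comul 1 p (cst k (one_mul p).symm c)))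
    = (α p).symm c
  comul_counit' : ∀ (p : G) (c : H p),
    (TensorProduct.rid k (H p))
      ((TensorProduct.map LinearMap.id counit) (comul p 1 (cst k (mul_one p).symm c)))
    = (α p).symm c
  comul_αinv : ∀ (p q : G) (c : H (p * q)),
    comul p q ((α (p * q)).symm c)
      = TensorProduct.map (α p).symm.toLinearMap (α q).symm.toLinearMap (comul p q c)
  counit_αinv : ∀ c : H (1 : G), counit ((α 1).symm c) = counit c
  comul_mul : ∀ (p q : G) (a b : H (p * q)),
    comul p q (mul (p * q) a b)
      = TensorProduct.map₂ (mul p) (mul q) (comul p q a) (comul p q b)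
  comul_one : ∀ p q : G, comul p q (one (p * q)) = (one p) ⊗ₜ[k] (one q)
  counit_mul : ∀ a b : H (1 : G), counit (mul 1 a b) = counit a * counit b
  counit_one : counit (one 1) = 1
  antipode_α : ∀ (p : G) (h : H p), antipode p (α p h) = (α p⁻¹) (antipode p h)
  antipode_left : ∀ (p : G) (h : H (1 : G)),
    TensorProduct.lift (mul p)
      ((TensorProduct.map ((cst k (inv_inv p)).comp (antipode p⁻¹)) LinearMap.id)
        (comul p⁻¹ p (cst k (show (1 : G) = p⁻¹ * p by group) h)))
    = counit h • one p
  antipode_right : ∀ (p : G) (h : H (1 : G)),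
    TensorProduct.lift (mul p)
      ((TensorProduct.map LinearMap.id ((cst k (inv_inv p)).comp (antipode p⁻¹)))
        (comul p p⁻¹ (cst k (show (1 : G) = p * p⁻¹ by group) h)))
    = counit h • one p

/-- The axioms of a crossing on a group-cograded (monoidal Hom-)Hopf algebra. -/
structure IsCrossing (k : Type*) [Field k] {G : Type*} [Group G] {H : G → Type*}
    [∀ p, AddCommGroup (H p)] [∀ p, Module k (H p)]
    (mul : ∀ p : G, H p →ₗ[k] H p →ₗ[k] H p) (one : ∀ p : G, H p)
    (comul : ∀ p q : G, H (p * q) →ₗ[k] H p ⊗[k] H q) (counit : H (1 : G) →ₗ[k] k)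
    (α : ∀ p : G, H p ≃ₗ[k] H p)
    (π : ∀ q p : G, H p ≃ₗ[k] H (q * p * q⁻¹)) : Prop where
  π_mul : ∀ (q p : G) (a b : H p),
    π q p (mul p a b) = mul (q * p * q⁻¹) (π q p a) (π q p b)
  π_one : ∀ q p : G, π q p (one p) = one (q * p * q⁻¹)
  π_α : ∀ (q p : G) (a : H p), π q p (α p a) = α (q * p * q⁻¹) (π q p a)
  π_comul : ∀ (q a b : G) (c : H (a * b)),
    TensorProduct.map (π q a).toLinearMap (π q b).toLinearMap (comul a b c)
      = comul (q * a * q⁻¹) (q * b * q⁻¹)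
          (cst k (show q * (a * b) * q⁻¹ = (q * a * q⁻¹) * (q * b * q⁻¹) by group) (π q (a * b) c))
  π_counit : ∀ (q : G) (c : H (1 : G)),
    counit (cst k (show q * (1 : G) * q⁻¹ = 1 by group) (π q 1 c)) = counit c
  π_mult : ∀ (a b p : G) (c : H p),
    cst k (show (a * b) * p * (a * b)⁻¹ = a * (b * p * b⁻¹) * a⁻¹ by group) (π (a * b) p c)
      = π a (b * p * b⁻¹) (π b p c)

/-- A (classical) Hopf `T`-coalgebra: a Hopf group-coalgebra with a crossing. -/
structure HopfTC (k : Type*) [Field k] (G : Type*) [Group G] (H : G → Type*)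
    [∀ p, AddCommGroup (H p)] [∀ p, Module k (H p)] extends HopfGC k G H where
  π : ∀ q p : G, H p ≃ₗ[k] H (q * p * q⁻¹)
  π_mul : ∀ (q p : G) (a b : H p),
    π q p (mul p a b) = mul (q * p * q⁻¹) (π q p a) (π q p b)
  π_one : ∀ q p : G, π q p (one p) = one (q * p * q⁻¹)
  π_comul : ∀ (q a b : G) (c : H (a * b)),
    TensorProduct.map (π q a).toLinearMap (π q b).toLinearMap (comul a b c)
      = comul (q * a * q⁻¹) (q * b * q⁻¹)
          (cst k (show q * (a * b) * q⁻¹ = (q * a * q⁻¹) * (q * b * q⁻¹) by group) (π q (a * b) c))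
  π_counit : ∀ (q : G) (c : H (1 : G)),
    counit (cst k (show q * (1 : G) * q⁻¹ = 1 by group) (π q 1 c)) = counit c
  π_antipode : ∀ (q p : G) (h : H p),
    antipode (q * p * q⁻¹) (π q p h)
      = cst k (show q * p⁻¹ * q⁻¹ = (q * p * q⁻¹)⁻¹ by group) (π q p⁻¹ (antipode p h))
  π_mult : ∀ (a b p : G) (c : H p),
    cst k (show (a * b) * p * (a * b)⁻¹ = a * (b * p * b⁻¹) * a⁻¹ by group) (π (a * b) p c)
      = π a (b * p * b⁻¹) (π b p c)

/-- A group-cograded monoidal Hom-Hopf algebra (bundled data). -/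
structure GCHH (k : Type*) [Field k] (G : Type*) [Group G] (H : G → Type*)
    [∀ p, AddCommGroup (H p)] [∀ p, Module k (H p)] where
  mul : ∀ p : G, H p →ₗ[k] H p →ₗ[k] H p
  one : ∀ p : G, H p
  comul : ∀ p q : G, H (p * q) →ₗ[k] H p ⊗[k] H q
  counit : H (1 : G) →ₗ[k] k
  antipode : ∀ p : G, H p →ₗ[k] H p⁻¹
  α : ∀ p : G, H p ≃ₗ[k] H p
  ax : IsGCHH k mul one comul counit antipode α

/-- A monoidal Hom-Hopf `T`-coalgebra with bijective antipode (bundled data). -/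
structure HomTC (k : Type*) [Field k] (G : Type*) [Group G] (H : G → Type*)
    [∀ p, AddCommGroup (H p)] [∀ p, Module k (H p)] where
  mul : ∀ p : G, H p →ₗ[k] H p →ₗ[k] H p
  one : ∀ p : G, H p
  comul : ∀ p q : G, H (p * q) →ₗ[k] H p ⊗[k] H q
  counit : H (1 : G) →ₗ[k] k
  antipode : ∀ p : G, H p ≃ₗ[k] H p⁻¹
  α : ∀ p : G, H p ≃ₗ[k] H p
  π : ∀ q p : G, H p ≃ₗ[k] H (q * p * q⁻¹)
  ax : IsGCHH k mul one comul counit (fun p => (antipode p).toLinearMap) α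
  cax : IsCrossing k mul one comul counit α π

section YD

variable {k : Type*} [Field k] {G : Type*} [Group G] {H : G → Type*}
  [∀ p, AddCommGroup (H p)] [∀ p, Module k (H p)]

variable (k)

/-- The Yetter-Drinfeld compatibility condition (3) of Definition 4.1. -/
def YDcompat (T : HomTC k G H) (p : G) {M : Type*} [AddCommGroup M] [Module k M]
    (μ : M ≃ₗ[k] M) (act : H p →ₗ[k] M →ₗ[k] M)
    (ρ : ∀ r : G, M →ₗ[k] M ⊗[k] H r) : Prop :=
  ∀ r : G,
    (TensorProduct.map (TensorProduct.lift act) (TensorProduct.lift (T.mul r))).comp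
      ((TensorProduct.tensorTensorTensorComm k (H p) (H r) M (H r)).toLinearMap.comp
        (TensorProduct.map (T.comul p r) (ρ r)))
    =
    (TensorProduct.map μ.toLinearMap (TensorProduct.lift (T.mul r))).comp
      ((TensorProduct.assoc k M (H r) (H r)).toLinearMap.comp
        (((TensorProduct.comm k (H r) (M ⊗[k] H r)).toLinearMap).comp
          ((TensorProduct.map
              ((cst k (show p⁻¹ * (p * r * p⁻¹) * p⁻¹⁻¹ = r by group)).comp
                (T.π p⁻¹ (p * r * p⁻¹)).toLinearMap)
              ((ρ r).comp (TensorProduct.lift act))).comp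
            ((TensorProduct.assoc k (H (p * r * p⁻¹)) (H p) M).toLinearMap.comp
              (TensorProduct.map
                ((T.comul (p * r * p⁻¹) p).comp
                  (cst k (show p * r = (p * r * p⁻¹) * p by group)))
                μ.symm.toLinearMap)))))

/-- The axioms of a (left-right) `p`-Yetter-Drinfeld module over a monoidal Hom-Hopf
`T`-coalgebra. -/
structure IsYD (T : HomTC k G H) (p : G) {M : Type*} [AddCommGroup M] [Module k M]
    (μ : M ≃ₗ[k] M) (act : H p →ₗ[k] M →ₗ[k] M)
    (ρ : ∀ r : G, M →ₗ[k] M ⊗[k] H r) : Prop where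
  act_act : ∀ (a b : H p) (m : M), act (T.α p a) (act b m) = act (T.mul p a b) (μ m)
  act_one : ∀ m : M, act (T.one p) m = μ m
  μ_act : ∀ (a : H p) (m : M), μ (act a m) = act (T.α p a) (μ m)
  ρ_coassoc : ∀ a b : G,
    (TensorProduct.map μ.symm.toLinearMap (T.comul a b)).comp (ρ (a * b))
    = (TensorProduct.assoc k M (H a) (H b)).toLinearMap.comp
        ((TensorProduct.map (ρ a) (T.α b).symm.toLinearMap).comp (ρ b))
  ρ_counit : ∀ m : M,
    (TensorProduct.rid k M) ((TensorProduct.map LinearMap.id T.counit) (ρ 1 m)) = μ.symm m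
  ρ_μ : ∀ r : G,
    (ρ r).comp μ.toLinearMap
      = (TensorProduct.map μ.toLinearMap (T.α r).toLinearMap).comp (ρ r)
  compat : YDcompat k T p μ act ρ

/-- The action of `H (a*b)` on a tensor product of an `H a`-module and an `H b`-module. -/
def tAct (T : HomTC k G H) (a b : G) {M N : Type*} [AddCommGroup M] [Module k M]
    [AddCommGroup N] [Module k N]
    (actM : H a →ₗ[k] M →ₗ[k] M) (actN : H b →ₗ[k] N →ₗ[k] N) :
    H (a * b) →ₗ[k] (M ⊗[k] N) →ₗ[k] (M ⊗[k] N) :=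
  (TensorProduct.map₂ actM actN).comp (T.comul a b)

/-- The coaction on the tensor product `M ⊗ N`, where `N` has degree `b`:
`ρ r (m ⊗ n) = m₍₀₎ ⊗ n₍₀₎ ⊗ n₍₁,r₎ ⬝ π_{b⁻¹}(m₍₁,brb⁻¹₎)`. -/
def tCoact (T : HomTC k G H) (b : G) {M N : Type*} [AddCommGroup M] [Module k M]
    [AddCommGroup N] [Module k N]
    (ρM : ∀ r : G, M →ₗ[k] M ⊗[k] H r) (ρN : ∀ r : G, N →ₗ[k] N ⊗[k] H r) (r : G) :
    (M ⊗[k] N) →ₗ[k] (M ⊗[k] N) ⊗[k] H r :=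
  (TensorProduct.map LinearMap.id
      (TensorProduct.lift (((T.mul r).flip).comp
        ((cst k (show b⁻¹ * (b * r * b⁻¹) * b⁻¹⁻¹ = r by group)).comp
          (T.π b⁻¹ (b * r * b⁻¹)).toLinearMap)))).comp
    ((TensorProduct.tensorTensorTensorComm k M (H (b * r * b⁻¹)) N (H r)).toLinearMap.comp
      (TensorProduct.map (ρM (b * r * b⁻¹)) (ρN r)))

/-- The conjugate action on `ᵠM`: `h ⇀ m = π_{s⁻¹}(h) ⬝ m`. -/
def cAct (T : HomTC k G H) (s p : G) {M : Type*} [AddCommGroup M] [Module k M]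
    (act : H p →ₗ[k] M →ₗ[k] M) : H (s * p * s⁻¹) →ₗ[k] M →ₗ[k] M :=
  act.comp ((cst k (show s⁻¹ * (s * p * s⁻¹) * s⁻¹⁻¹ = p by group)).comp
    (T.π s⁻¹ (s * p * s⁻¹)).toLinearMap)

/-- The conjugate coaction on `ˢM`: `ρ r m = m₍₀₎ ⊗ π_s (m₍₁,s⁻¹rs₎)`. -/
def cCoact (T : HomTC k G H) (s : G) {M : Type*} [AddCommGroup M] [Module k M]
    (ρ : ∀ r : G, M →ₗ[k] M ⊗[k] H r) (r : G) : M →ₗ[k] M ⊗[k] H r :=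
  (TensorProduct.map LinearMap.id
      ((cst k (show s * (s⁻¹ * r * s) * s⁻¹ = r by group)).comp
        (T.π s (s⁻¹ * r * s)).toLinearMap)).comp
    (ρ (s⁻¹ * r * s))

/-- The Hom-associator `(A ⊗ B) ⊗ C ≃ A ⊗ (B ⊗ C)`, `(a ⊗ b) ⊗ c ↦ φA a ⊗ (b ⊗ φC⁻¹ c)`. -/
def homAssoc {A B C : Type*} [AddCommGroup A] [Module k A] [AddCommGroup B] [Module k B]
    [AddCommGroup C] [Module k C] (φA : A ≃ₗ[k] A) (φC : C ≃ₗ[k] C) :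
    (A ⊗[k] B) ⊗[k] C ≃ₗ[k] A ⊗[k] (B ⊗[k] C) :=
  (TensorProduct.assoc k A B C).trans
    (TensorProduct.congr φA (TensorProduct.congr (LinearEquiv.refl k B) φC.symm))

/-- The braiding `c_{M,W} : M ⊗ W → ᴹW ⊗ M`,
`m ⊗ w ↦ (S_{w⁻¹}(m₍₁,w⁻¹₎) ⬝ φW⁻¹ w) ⊗ μ m₍₀₎`, where `W` has degree `w`. -/
def braid (T : HomTC k G H) (w : G) {M W : Type*} [AddCommGroup M] [Module k M]
    [AddCommGroup W] [Module k W] (μ : M ≃ₗ[k] M) (ρM : ∀ r : G, M →ₗ[k] M ⊗[k] H r)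
    (actW : H w →ₗ[k] W →ₗ[k] W) (φW : W ≃ₗ[k] W) : (M ⊗[k] W) →ₗ[k] (W ⊗[k] M) :=
  (TensorProduct.comm k M W).toLinearMap.comp
    ((TensorProduct.map μ.toLinearMap
        (TensorProduct.lift (actW.comp
          ((cst k (inv_inv w)).comp (T.antipode w⁻¹).toLinearMap)))).comp
      ((TensorProduct.assoc k M (H w⁻¹) W).toLinearMap.comp
        (TensorProduct.map (ρM w⁻¹) φW.symm.toLinearMap)))

end YD

/-- The axioms of a monoidal Hom-Hopf algebra on a single space. -/
structure IsMonHomHopf (k : Type*) [Field k] (A : Type*) [AddCommGroup A] [Module k A]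
    (mul : A →ₗ[k] A →ₗ[k] A) (one : A) (comul : A →ₗ[k] A ⊗[k] A) (counit : A →ₗ[k] k)
    (S : A →ₗ[k] A) (α : A ≃ₗ[k] A) : Prop where
  hom_assoc : ∀ a b c : A, mul (α a) (mul b c) = mul (mul a b) (α c)
  one_mul' : ∀ a : A, mul one a = α a
  mul_one' : ∀ a : A, mul a one = α a
  α_mul : ∀ a b : A, α (mul a b) = mul (α a) (α b)
  α_one : α one = one
  hcoassoc :
    (TensorProduct.map α.symm.toLinearMap comul).comp comul
    = (TensorProduct.assoc k A A A).toLinearMap.comp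
        ((TensorProduct.map comul α.symm.toLinearMap).comp comul)
  counit_comul' : ∀ a : A,
    (TensorProduct.lid k A) ((TensorProduct.map counit LinearMap.id) (comul a)) = α.symm a
  comul_counit' : ∀ a : A,
    (TensorProduct.rid k A) ((TensorProduct.map LinearMap.id counit) (comul a)) = α.symm a
  comul_αinv : ∀ a : A,
    comul (α.symm a) = TensorProduct.map α.symm.toLinearMap α.symm.toLinearMap (comul a)
  counit_αinv : ∀ a : A, counit (α.symm a) = counit a
  comul_mul : ∀ a b : A, comul (mul a b) = TensorProduct.map₂ mul mul (comul a) (comul b)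
  comul_one : comul one = one ⊗ₜ[k] one
  counit_mul : ∀ a b : A, counit (mul a b) = counit a * counit b
  counit_one : counit one = 1
  antipode_α : ∀ a : A, S (α a) = α (S a)
  antipode_left : ∀ a : A,
    TensorProduct.lift mul ((TensorProduct.map S LinearMap.id) (comul a)) = counit a • one
  antipode_right : ∀ a : A,
    TensorProduct.lift mul ((TensorProduct.map LinearMap.id S) (comul a)) = counit a • one

section Classical

variable {k : Type*} [Field k]
  {A B C D E F I M N : Type*}
  [AddCommGroup A] [Module k A] [AddCommGroup B] [Module k B] [AddCommGroup C] [Module k C]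
  [AddCommGroup D] [Module k D] [AddCommGroup E] [Module k E] [AddCommGroup F] [Module k F]
  [AddCommGroup I] [Module k I] [AddCommGroup M] [Module k M] [AddCommGroup N] [Module k N]

/-- The operator-valued bilinear map `(x, y) ↦ f x ∘ g y`. -/
def compBilin {P Q R : Type*} [AddCommGroup P] [Module k P] [AddCommGroup Q] [Module k Q]
    [AddCommGroup R] [Module k R] (f : A →ₗ[k] Q →ₗ[k] R) (g : B →ₗ[k] P →ₗ[k] Q) :
    A →ₗ[k] B →ₗ[k] P →ₗ[k] R :=
  (LinearMap.llcomp k P Q R).compl₁₂ f g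

@[simp]
lemma compBilin_apply {P Q R : Type*} [AddCommGroup P] [Module k P] [AddCommGroup Q] [Module k Q]
    [AddCommGroup R] [Module k R] (f : A →ₗ[k] Q →ₗ[k] R) (g : B →ₗ[k] P →ₗ[k] Q)
    (a : A) (b : B) (x : P) : compBilin f g a b x = f a (g b x) := rfl

/-- Right multiplication by `π d` on the second factor of `N ⊗ B`. -/
def rightOp (N : Type*) [AddCommGroup N] [Module k N] (mul : B →ₗ[k] B →ₗ[k] B)
    (π : D →ₗ[k] B) : D →ₗ[k] (N ⊗[k] B) →ₗ[k] (N ⊗[k] B) :=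
  (LinearMap.lTensorHom N).comp (mul.flip.comp π)

@[simp]
lemma rightOp_tmul (mul : B →ₗ[k] B →ₗ[k] B) (π : D →ₗ[k] B) (d : D) (n : N) (b : B) :
    rightOp N mul π d (n ⊗ₜ[k] b) = n ⊗ₜ[k] mul b (π d) := rfl

/-- Left multiplication on the second factor of `N ⊗ B`. -/
def leftOp (N : Type*) [AddCommGroup N] [Module k N] (mul : B →ₗ[k] B →ₗ[k] B) :
    B →ₗ[k] (N ⊗[k] B) →ₗ[k] (N ⊗[k] B) :=
  (LinearMap.lTensorHom N).comp mul

@[simp]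
lemma leftOp_tmul (mul : B →ₗ[k] B →ₗ[k] B) (b' : B) (n : N) (b : B) :
    leftOp N mul b' (n ⊗ₜ[k] b) = n ⊗ₜ[k] mul b' b := rfl

/-- The action of `A` on the first factor of `N ⊗ B`. -/
def fstOp (B : Type*) [AddCommGroup B] [Module k B] (act : A →ₗ[k] N →ₗ[k] N) :
    A →ₗ[k] (N ⊗[k] B) →ₗ[k] (N ⊗[k] B) :=
  (LinearMap.rTensorHom B).comp act

@[simp]
lemma fstOp_tmul (act : A →ₗ[k] N →ₗ[k] N) (a : A) (n : N) (b : B) :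
    fstOp B act a (n ⊗ₜ[k] b) = act a n ⊗ₜ[k] b := rfl

/-- `h₁ · (S h₃ · n)₍₀₎ ⊗ h₂ (S h₃ · n)₍₁₎ = n₍₀₎ ⊗ n₍₁₎ π(h)`. -/
lemma map₂_coact_antipode (mulA : A →ₗ[k] A →ₗ[k] A) (oneA : A) (mulB : B →ₗ[k] B →ₗ[k] B)
    (act : A →ₗ[k] N →ₗ[k] N) (ρ : N →ₗ[k] N ⊗[k] B) (π : D →ₗ[k] B) (S : C →ₗ[k] A)
    (ε : I →ₗ[k] k) (ΔAB : E →ₗ[k] A ⊗[k] B) (ΔDA : E →ₗ[k] D ⊗[k] A) (ΔEC : D →ₗ[k] E ⊗[k] C)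
    (ΔDI : D →ₗ[k] D ⊗[k] I) (ΔAC : I →ₗ[k] A ⊗[k] C)
    (act_mul : ∀ a b n, act (mulA a b) n = act a (act b n)) (act_one : ∀ n, act oneA n = n)
    (compat : ∀ e n, TensorProduct.map₂ act mulB (ΔAB e) (ρ n)
      = TensorProduct.lift (compBilin (rightOp N mulB π) (act.compr₂ ρ)) (ΔDA e) n)
    (coassoc : ∀ d, TensorProduct.map LinearMap.id ΔAC (ΔDI d)
      = TensorProduct.assoc k D A C (TensorProduct.map ΔDA LinearMap.id (ΔEC d)))
    (counit : ∀ d, TensorProduct.rid k D (TensorProduct.map LinearMap.id ε (ΔDI d)) = d)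
    (antipode : ∀ h, TensorProduct.lift mulA (TensorProduct.map LinearMap.id S (ΔAC h))
      = ε h • oneA) (d : D) (n : N) :
    TensorProduct.lift (compBilin ((TensorProduct.map₂ act mulB).comp ΔAB)
      ((act.comp S).compr₂ ρ)) (ΔEC d) n = rightOp N mulB π d (ρ n) := by
  have h1 : ∀ t : E ⊗[k] C, TensorProduct.lift (compBilin ((TensorProduct.map₂ act mulB).comp ΔAB)
      ((act.comp S).compr₂ ρ)) t n
      = TensorProduct.lift (compBilin (rightOp N mulB π)
          (TensorProduct.lift (compBilin (act.compr₂ ρ) (act.comp S))))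
          (TensorProduct.assoc k D A C (TensorProduct.map ΔDA LinearMap.id t)) n := by
    intro t
    induction t using TensorProduct.induction_on with
    | zero => simp
    | add x y hx hy => simp only [map_add, LinearMap.add_apply, hx, hy]
    | tmul e s =>
      have h2 : ∀ x : D ⊗[k] A,
          TensorProduct.lift (compBilin (rightOp N mulB π) (act.compr₂ ρ)) x (act (S s) n)
          = TensorProduct.lift (compBilin (rightOp N mulB π)
          (TensorProduct.lift (compBilin (act.compr₂ ρ) (act.comp S))))
          (TensorProduct.assoc k D A C (x ⊗ₜ s)) n := by
        intro x
        induction x using TensorProduct.induction_on with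
        | zero => simp
        | add x y hx hy => simp only [map_add, LinearMap.add_apply, TensorProduct.add_tmul, hx, hy]
        | tmul u v => simp
      simp [compat, h2]
  have h3 : ∀ z : D ⊗[k] I, TensorProduct.lift (compBilin (rightOp N mulB π)
          (TensorProduct.lift (compBilin (act.compr₂ ρ) (act.comp S))))
          (TensorProduct.map LinearMap.id ΔAC z) n
      = rightOp N mulB π (TensorProduct.rid k D (TensorProduct.map LinearMap.id ε z)) (ρ n) := by
    intro z
    induction z using TensorProduct.induction_on with
    | zero => simp
    | add x y hx hy => simp only [map_add, LinearMap.add_apply, hx, hy]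
    | tmul u i =>
      have h4 : ∀ y : A ⊗[k] C,
          TensorProduct.lift (compBilin (act.compr₂ ρ) (act.comp S)) y n
          = ρ (act (TensorProduct.lift mulA (TensorProduct.map LinearMap.id S y)) n) := by
        intro y
        induction y using TensorProduct.induction_on with
        | zero => simp
        | add x y hx hy => simp only [map_add, LinearMap.add_apply, hx, hy]
        | tmul a c => simp [act_mul]
      simp [h4, antipode, act_one]
  rw [h1, ← coassoc, h3, counit]

/-- `(S h₂ · n)₍₀₎ ⊗ h₁ (S h₂ · n)₍₁₎ = S h₁ · n₍₀₎ ⊗ n₍₁₎ π(h₂)`. -/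
lemma leftOp_coact_antipode (mulA : A →ₗ[k] A →ₗ[k] A) (oneA : A) (mulB : B →ₗ[k] B →ₗ[k] B)
    (act : A →ₗ[k] N →ₗ[k] N) (ρ : N →ₗ[k] N ⊗[k] B) (π : D →ₗ[k] B) (S : C →ₗ[k] A)
    (ε : I →ₗ[k] k) (ΔAB : E →ₗ[k] A ⊗[k] B) (ΔEC : D →ₗ[k] E ⊗[k] C)
    (ΔCA : I →ₗ[k] C ⊗[k] A) (ΔIB : B →ₗ[k] I ⊗[k] B) (ΔCE : B →ₗ[k] C ⊗[k] E)
    (ΔCD : F →ₗ[k] C ⊗[k] D) (ΔBC : F →ₗ[k] B ⊗[k] C)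
    (act_mul : ∀ a b n, act (mulA a b) n = act a (act b n)) (act_one : ∀ n, act oneA n = n)
    (key : ∀ d n, TensorProduct.lift (compBilin ((TensorProduct.map₂ act mulB).comp ΔAB)
      ((act.comp S).compr₂ ρ)) (ΔEC d) n = rightOp N mulB π d (ρ n))
    (coassocF : ∀ f, TensorProduct.map LinearMap.id ΔEC (ΔCD f)
      = TensorProduct.assoc k C E C (TensorProduct.map ΔCE LinearMap.id (ΔBC f)))
    (coassocB : ∀ b, TensorProduct.map LinearMap.id ΔAB (ΔCE b)
      = TensorProduct.assoc k C A B (TensorProduct.map ΔCA LinearMap.id (ΔIB b)))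
    (counit : ∀ b, TensorProduct.lid k B (TensorProduct.map ε LinearMap.id (ΔIB b)) = b)
    (antipode : ∀ h, TensorProduct.lift mulA (TensorProduct.map S LinearMap.id (ΔCA h))
      = ε h • oneA) (f : F) (n : N) :
    TensorProduct.lift (compBilin (leftOp N mulB) ((act.comp S).compr₂ ρ)) (ΔBC f) n
      = TensorProduct.lift (compBilin (fstOp B (act.comp S))
          ((LinearMap.lcomp k (N ⊗[k] B) ρ).comp (rightOp N mulB π))) (ΔCD f) n := by
  set Q := compBilin ((TensorProduct.map₂ act mulB).comp ΔAB) ((act.comp S).compr₂ ρ) with hQ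
  have h1 : ∀ t : C ⊗[k] D, TensorProduct.lift (compBilin (fstOp B (act.comp S))
          ((LinearMap.lcomp k (N ⊗[k] B) ρ).comp (rightOp N mulB π))) t n
      = TensorProduct.lift (compBilin (fstOp B (act.comp S)) (TensorProduct.lift Q))
          (TensorProduct.map LinearMap.id ΔEC t) n := by
    intro t
    induction t using TensorProduct.induction_on with
    | zero => simp
    | add x y hx hy => simp only [map_add, LinearMap.add_apply, hx, hy]
    | tmul c d => simp [key, LinearMap.lcomp_apply]
  have h2 : ∀ (s : C) (x : C ⊗[k] E),
      TensorProduct.lift (compBilin (fstOp B (act.comp S)) (TensorProduct.lift Q))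
        (TensorProduct.assoc k C E C (x ⊗ₜ s)) n
      = TensorProduct.lift (compBilin (fstOp B (act.comp S)) (TensorProduct.map₂ act mulB))
          (TensorProduct.map LinearMap.id ΔAB x) (ρ (act (S s) n)) := by
    intro s x
    induction x using TensorProduct.induction_on with
    | zero => simp
    | add x y hx hy => simp only [map_add, LinearMap.add_apply, TensorProduct.add_tmul, hx, hy]
    | tmul c e => simp [hQ]
  have h3 : ∀ (b : B) (y : C ⊗[k] A) (w : N ⊗[k] B),
      TensorProduct.lift (compBilin (fstOp B (act.comp S)) (TensorProduct.map₂ act mulB))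
        (TensorProduct.assoc k C A B (y ⊗ₜ b)) w
      = TensorProduct.map (act (TensorProduct.lift mulA (TensorProduct.map S LinearMap.id y)))
          (mulB b) w := by
    intro b y w
    induction y using TensorProduct.induction_on with
    | zero => simp
    | add x y hx hy =>
      simp only [map_add, LinearMap.add_apply, TensorProduct.add_tmul, hx, hy,
        TensorProduct.map_add_left]
    | tmul c a =>
      induction w using TensorProduct.induction_on with
      | zero => simp
      | add x y hx hy => rw [map_add, map_add, hx, hy]
      | tmul n b => simp [act_mul]
  have act_one' : act oneA = LinearMap.id := LinearMap.ext act_one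
  have h4 : ∀ (z : I ⊗[k] B) (w : N ⊗[k] B),
      TensorProduct.lift (compBilin (fstOp B (act.comp S)) (TensorProduct.map₂ act mulB))
        (TensorProduct.assoc k C A B (TensorProduct.map ΔCA LinearMap.id z)) w
      = leftOp N mulB (TensorProduct.lid k B (TensorProduct.map ε LinearMap.id z)) w := by
    intro z w
    induction z using TensorProduct.induction_on with
    | zero => simp
    | add x y hx hy => simp only [map_add, LinearMap.add_apply, hx, hy]
    | tmul i b =>
      rw [TensorProduct.map_tmul, LinearMap.id_apply, h3, antipode, map_smul, act_one',
        TensorProduct.map_smul_left]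
      simp [leftOp, LinearMap.lTensor]
  have h5 : ∀ u : B ⊗[k] C,
      TensorProduct.lift (compBilin (fstOp B (act.comp S)) (TensorProduct.lift Q))
        (TensorProduct.assoc k C E C (TensorProduct.map ΔCE LinearMap.id u)) n
      = TensorProduct.lift (compBilin (leftOp N mulB) ((act.comp S).compr₂ ρ)) u n := by
    intro u
    induction u using TensorProduct.induction_on with
    | zero => simp
    | add x y hx hy => simp only [map_add, LinearMap.add_apply, hx, hy]
    | tmul b s =>
      rw [TensorProduct.map_tmul, LinearMap.id_apply, h2, coassocB, h4, counit]
      simp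
  rw [h1, coassocF, h5]

/-- The untwisted braiding `m ⊗ n ↦ S(m₍₁₎) · n ⊗ m₍₀₎`. -/
def plainBraid (act : A →ₗ[k] N →ₗ[k] N) (S : C →ₗ[k] A) (ρM : M →ₗ[k] M ⊗[k] C) :
    M ⊗[k] N →ₗ[k] N ⊗[k] M :=
  (TensorProduct.comm k M N).toLinearMap.comp
    ((TensorProduct.map LinearMap.id (TensorProduct.lift (act.comp S))).comp
      ((TensorProduct.assoc k M C N).toLinearMap.comp (TensorProduct.map ρM LinearMap.id)))

/-- The coaction `x ⊗ y ↦ x₍₀₎ ⊗ y₍₀₎ ⊗ y₍₁₎ π(x₍₁₎)`. -/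
def plainCoact {X Y : Type*} [AddCommGroup X] [Module k X] [AddCommGroup Y] [Module k Y]
    (mul : B →ₗ[k] B →ₗ[k] B) (π : D →ₗ[k] B) (ρX : X →ₗ[k] X ⊗[k] D)
    (ρY : Y →ₗ[k] Y ⊗[k] B) : X ⊗[k] Y →ₗ[k] (X ⊗[k] Y) ⊗[k] B :=
  (TensorProduct.map LinearMap.id (TensorProduct.lift (mul.flip.comp π))).comp
    ((TensorProduct.tensorTensorTensorComm k X D Y B).toLinearMap.comp
      (TensorProduct.map ρX ρY))

/-- Insertion `m ↦ (n ⊗ b ↦ (n ⊗ m) ⊗ b)`. -/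
def insertMid (k : Type*) [Field k] (M N B : Type*) [AddCommGroup M] [Module k M]
    [AddCommGroup N] [Module k N] [AddCommGroup B] [Module k B] :
    M →ₗ[k] (N ⊗[k] B) →ₗ[k] ((N ⊗[k] M) ⊗[k] B) :=
  (LinearMap.rTensorHom B).comp (TensorProduct.mk k N M).flip

@[simp]
lemma insertMid_tmul (m : M) (n : N) (b : B) :
    insertMid k M N B m (n ⊗ₜ[k] b) = (n ⊗ₜ[k] m) ⊗ₜ[k] b := rfl

lemma plainCoact_plainBraid (mulB : B →ₗ[k] B →ₗ[k] B)
    (act : A →ₗ[k] N →ₗ[k] N) (ρ : N →ₗ[k] N ⊗[k] B) (π : D →ₗ[k] B) (S : C →ₗ[k] A)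
    (ΔCD : F →ₗ[k] C ⊗[k] D) (ΔBC : F →ₗ[k] B ⊗[k] C)
    (ρB : M →ₗ[k] M ⊗[k] B) (ρC : M →ₗ[k] M ⊗[k] C) (ρD : M →ₗ[k] M ⊗[k] D)
    (ρF : M →ₗ[k] M ⊗[k] F)
    (key : ∀ f n, TensorProduct.lift (compBilin (leftOp N mulB) ((act.comp S).compr₂ ρ)) (ΔBC f) n
      = TensorProduct.lift (compBilin (fstOp B (act.comp S))
          ((LinearMap.lcomp k (N ⊗[k] B) ρ).comp (rightOp N mulB π))) (ΔCD f) n)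
    (coassocBC : ∀ m, TensorProduct.map LinearMap.id ΔBC (ρF m)
      = TensorProduct.assoc k M B C (TensorProduct.map ρB LinearMap.id (ρC m)))
    (coassocCD : ∀ m, TensorProduct.map LinearMap.id ΔCD (ρF m)
      = TensorProduct.assoc k M C D (TensorProduct.map ρC LinearMap.id (ρD m))) :
    (plainCoact mulB LinearMap.id ρ ρB).comp (plainBraid act S ρC)
      = (TensorProduct.map (plainBraid act S ρC) LinearMap.id).comp
          (plainCoact mulB π ρD ρ) := by
  refine TensorProduct.ext' fun m n => ?_
  have hL : ∀ t : M ⊗[k] C,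
      plainCoact mulB LinearMap.id ρ ρB (TensorProduct.comm k M N
        (TensorProduct.map LinearMap.id (TensorProduct.lift (act.comp S))
          (TensorProduct.assoc k M C N (t ⊗ₜ n))))
      = TensorProduct.lift (compBilin (insertMid k M N B)
          ((TensorProduct.lift (compBilin (leftOp N mulB) ((act.comp S).compr₂ ρ)))))
          (TensorProduct.assoc k M B C (TensorProduct.map ρB LinearMap.id t)) n := by
    intro t
    induction t using TensorProduct.induction_on with
    | zero => simp
    | add x y hx hy => simp only [map_add, LinearMap.add_apply, TensorProduct.add_tmul, hx, hy]
    | tmul m c =>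
      simp only [TensorProduct.map_tmul, TensorProduct.assoc_tmul, TensorProduct.comm_tmul,
        LinearMap.id_apply, TensorProduct.lift.tmul, LinearMap.comp_apply, plainCoact,
        LinearEquiv.coe_coe]
      generalize ρB m = x
      induction x using TensorProduct.induction_on with
      | zero => simp
      | add x y hx hy =>
        simp only [map_add, LinearMap.add_apply, TensorProduct.add_tmul, TensorProduct.tmul_add,
          hx, hy]
      | tmul m b =>
        simp only [TensorProduct.assoc_tmul, TensorProduct.lift.tmul, compBilin_apply,
          LinearMap.compr₂_apply, LinearMap.comp_apply]
        generalize ρ (act (S c) n) = y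
        induction y using TensorProduct.induction_on with
        | zero => simp
        | add x y hx hy => simp only [map_add, TensorProduct.add_tmul, hx, hy]
        | tmul n' b' => simp
  have hR : ∀ t : M ⊗[k] D,
      TensorProduct.map (plainBraid act S ρC) LinearMap.id
        (TensorProduct.map LinearMap.id (TensorProduct.lift (mulB.flip.comp π))
          (TensorProduct.tensorTensorTensorComm k M D N B (t ⊗ₜ ρ n)))
      = TensorProduct.lift (compBilin (insertMid k M N B)
          (TensorProduct.lift (compBilin (fstOp B (act.comp S))
          ((LinearMap.lcomp k (N ⊗[k] B) ρ).comp (rightOp N mulB π)))))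
          (TensorProduct.assoc k M C D (TensorProduct.map ρC LinearMap.id t)) n := by
    intro t
    induction t using TensorProduct.induction_on with
    | zero => simp
    | add x y hx hy => simp only [map_add, LinearMap.add_apply, TensorProduct.add_tmul, hx, hy]
    | tmul m d =>
      simp only [TensorProduct.map_tmul, LinearMap.id_apply]
      have : ∀ (x : M ⊗[k] C) (y : N ⊗[k] B),
          TensorProduct.lift (compBilin (insertMid k M N B)
          (TensorProduct.lift (compBilin (fstOp B (act.comp S))
          (rightOp N mulB π)))) (TensorProduct.assoc k M C D (x ⊗ₜ d)) y
          = TensorProduct.map ((TensorProduct.comm k M N).toLinearMap.comp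
    ((TensorProduct.map LinearMap.id (TensorProduct.lift (act.comp S))).comp
      ((TensorProduct.assoc k M C N).toLinearMap.comp
        (TensorProduct.mk k _ N x)))) (mulB.flip (π d)) y := by
        intro x y
        induction y using TensorProduct.induction_on with
        | zero => simp
        | add y z hy hz => simp only [map_add, hy, hz]
        | tmul n b =>
          induction x using TensorProduct.induction_on with
          | zero => simp
          | add y z hy hz =>
            simp only [map_add, TensorProduct.add_tmul, LinearMap.add_apply, hy, hz,
              LinearMap.comp_add, TensorProduct.map_add_left]
          | tmul m c => simp
      have h2 : ∀ (x : M ⊗[k] C),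
          TensorProduct.lift (compBilin (insertMid k M N B)
          (TensorProduct.lift (compBilin (fstOp B (act.comp S))
          ((LinearMap.lcomp k (N ⊗[k] B) ρ).comp (rightOp N mulB π)))))
            (TensorProduct.assoc k M C D (x ⊗ₜ d)) n
          = TensorProduct.lift (compBilin (insertMid k M N B)
          (TensorProduct.lift (compBilin (fstOp B (act.comp S))
          (rightOp N mulB π)))) (TensorProduct.assoc k M C D (x ⊗ₜ d)) (ρ n) := by
        intro x
        induction x using TensorProduct.induction_on with
        | zero => simp
        | add y z hy hz =>
          simp only [map_add, TensorProduct.add_tmul, LinearMap.add_apply, hy, hz]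
        | tmul m c => simp [LinearMap.lcomp_apply]
      rw [h2, this]
      generalize ρ n = y
      induction y using TensorProduct.induction_on with
      | zero => simp
      | add y z hy hz => simp only [map_add, TensorProduct.tmul_add, hy, hz]
      | tmul n b => simp [plainBraid]
  have hkey : ∀ t : M ⊗[k] F,
      TensorProduct.lift (compBilin (insertMid k M N B)
          ((TensorProduct.lift (compBilin (leftOp N mulB) ((act.comp S).compr₂ ρ)))))
        (TensorProduct.map LinearMap.id ΔBC t) n
      = TensorProduct.lift (compBilin (insertMid k M N B)
          (TensorProduct.lift (compBilin (fstOp B (act.comp S))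
          ((LinearMap.lcomp k (N ⊗[k] B) ρ).comp (rightOp N mulB π)))))
        (TensorProduct.map LinearMap.id ΔCD t) n := by
    intro t
    induction t using TensorProduct.induction_on with
    | zero => simp
    | add x y hx hy => simp only [map_add, LinearMap.add_apply, hx, hy]
    | tmul m f => simp [key]
  calc _ = _ := hL (ρC m)
    _ = _ := by rw [← coassocBC, hkey, coassocCD]
    _ = _ := (hR (ρD m)).symm

end Classical

section Twist

variable {k : Type*} [Field k] {G : Type*} [Group G] {H : G → Type*}
  [∀ p, AddCommGroup (H p)] [∀ p, Module k (H p)]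

omit [Group G] in
@[simp]
lemma cst_self {a : G} (h : a = a) (x : H a) : cst k h x = x := rfl

lemma cst_α (T : HomTC k G H) {a b : G} (h : a = b) (x : H a) :
    cst k h (T.α a x) = T.α b (cst k h x) := by
  subst h; rfl

namespace HomTC

/-- The multiplication of the untwisted algebra. -/
def untwistMul (T : HomTC k G H) (a : G) : H a →ₗ[k] H a →ₗ[k] H a :=
  (T.mul a).compr₂ (T.α a).symm.toLinearMap

@[simp]
lemma untwistMul_apply (T : HomTC k G H) (a : G) (x y : H a) :
    T.untwistMul a x y = (T.α a).symm (T.mul a x y) := rfl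

/-- The comultiplication of the untwisted coalgebra, with a free source index. -/
def untwistComul (T : HomTC k G H) {a b c : G} (h : c = a * b) : H c →ₗ[k] H a ⊗[k] H b :=
  (TensorProduct.map (T.α a).toLinearMap (T.α b).toLinearMap).comp
    ((T.comul a b).comp (cst k h))

/-- The crossing with a free target index. -/
def conj (T : HomTC k G H) (s : G) {a b : G} (h : s * a * s⁻¹ = b) : H a →ₗ[k] H b :=
  (cst k h).comp (T.π s a).toLinearMap

/-- The antipode with a free target index. -/
def antipodeTo (T : HomTC k G H) {a b : G} (h : a⁻¹ = b) : H a →ₗ[k] H b :=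
  (cst k h).comp (T.antipode a).toLinearMap

lemma conj_α (T : HomTC k G H) (s : G) {a b : G} (h : s * a * s⁻¹ = b) (x : H a) :
    T.conj s h (T.α a x) = T.α b (T.conj s h x) := by
  subst h
  exact T.cax.π_α s a x

lemma antipodeTo_α (T : HomTC k G H) {a b : G} (h : a⁻¹ = b) (x : H a) :
    T.antipodeTo h (T.α a x) = T.α b (T.antipodeTo h x) := by
  subst h
  exact T.ax.antipode_α a x

lemma conj_conj (T : HomTC k G H) (s t u : G) {a b c : G} (hu : s * t = u)
    (ht : t * a * t⁻¹ = b) (hs : s * b * s⁻¹ = c) (h : u * a * u⁻¹ = c) (x : H a) :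
    T.conj s hs (T.conj t ht x) = T.conj u h x := by
  subst hu ht hs
  exact (T.cax.π_mult s t a x).symm

lemma conj_one (T : HomTC k G H) {a b : G} (h : 1 * a * 1⁻¹ = b) (h' : a = b) (x : H a) :
    T.conj 1 h x = cst k h' x := by
  subst h'
  have inj : Function.Injective (T.conj 1 h) := by
    have hc : ∀ {c : G} (hc : 1 * a * 1⁻¹ = c), Function.Injective (T.conj 1 hc) := by
      intro c hc
      subst hc
      exact (T.π 1 a).injective
    exact hc h
  apply inj
  rw [cst_self]
  exact T.conj_conj 1 1 1 (one_mul 1) h h h x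

lemma conj_inv_conj (T : HomTC k G H) (s : G) {a b c : G}
    (hs : s * a * s⁻¹ = b) (hs' : s⁻¹ * b * s⁻¹⁻¹ = c) (h : a = c) (x : H a) :
    T.conj s⁻¹ hs' (T.conj s hs x) = cst k h x := by
  rw [T.conj_conj s⁻¹ s 1 (inv_mul_cancel s) hs hs' (by simpa using h), T.conj_one _ h]

lemma comul_α (T : HomTC k G H) (a b : G) (x : H (a * b)) :
    T.comul a b (T.α (a * b) x)
      = TensorProduct.map (T.α a).toLinearMap (T.α b).toLinearMap (T.comul a b x) := by
  have h := T.ax.comul_αinv a b (T.α (a * b) x)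
  rw [LinearEquiv.symm_apply_apply] at h
  rw [h, ← LinearMap.comp_apply, ← TensorProduct.map_comp]
  simp

lemma untwistComul_coassoc (T : HomTC k G H) {a b c ab bc abc : G} (h₁ : ab = a * b)
    (h₂ : bc = b * c) (h₃ : abc = ab * c) (h₄ : abc = a * bc) (x : H abc) :
    TensorProduct.map LinearMap.id (T.untwistComul h₂) (T.untwistComul h₄ x)
      = TensorProduct.assoc k (H a) (H b) (H c)
          (TensorProduct.map (T.untwistComul h₁) LinearMap.id (T.untwistComul h₃ x)) := by
  subst h₁ h₂ h₃
  have key := congrArg (TensorProduct.map ((T.α a).toLinearMap.comp (T.α a).toLinearMap)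
    (TensorProduct.map ((T.α b).toLinearMap.comp (T.α b).toLinearMap)
      ((T.α c).toLinearMap.comp (T.α c).toLinearMap)))
    (LinearMap.congr_fun (T.ax.hcoassoc a b c) x)
  simp only [LinearMap.comp_apply] at key
  have hl : ∀ y : H a ⊗[k] H (b * c),
      TensorProduct.map LinearMap.id (T.untwistComul rfl)
        (TensorProduct.map (T.α a).toLinearMap (T.α (b * c)).toLinearMap y)
      = TensorProduct.map ((T.α a).toLinearMap.comp (T.α a).toLinearMap)
    (TensorProduct.map ((T.α b).toLinearMap.comp (T.α b).toLinearMap)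
      ((T.α c).toLinearMap.comp (T.α c).toLinearMap))
        (TensorProduct.map (T.α a).symm.toLinearMap (T.comul b c) y) := by
    intro y
    induction y using TensorProduct.induction_on with
    | zero => simp
    | add y z hy hz => simp only [map_add, hy, hz]
    | tmul u v =>
      simp only [TensorProduct.map_tmul, untwistComul, LinearMap.comp_apply, cst_self,
        LinearEquiv.coe_coe, comul_α, LinearMap.id_apply, TensorProduct.map_comp,
        LinearEquiv.apply_symm_apply]
  have hr : ∀ y : H (a * b) ⊗[k] H c,
      TensorProduct.assoc k (H a) (H b) (H c)
        (TensorProduct.map (T.untwistComul rfl) LinearMap.id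
        (TensorProduct.map (T.α (a * b)).toLinearMap (T.α c).toLinearMap y))
      = TensorProduct.map ((T.α a).toLinearMap.comp (T.α a).toLinearMap)
    (TensorProduct.map ((T.α b).toLinearMap.comp (T.α b).toLinearMap)
      ((T.α c).toLinearMap.comp (T.α c).toLinearMap))
        (TensorProduct.assoc k (H a) (H b) (H c)
          (TensorProduct.map (T.comul a b) (T.α c).symm.toLinearMap y)) := by
    intro y
    induction y using TensorProduct.induction_on with
    | zero => simp
    | add y z hy hz => simp only [map_add, hy, hz]
    | tmul u v =>
      simp only [TensorProduct.map_tmul, untwistComul, LinearMap.comp_apply, cst_self,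
        LinearEquiv.coe_coe, comul_α, LinearMap.id_apply]
      generalize T.comul a b u = w
      induction w using TensorProduct.induction_on with
      | zero => simp
      | add y z hy hz => simp only [map_add, TensorProduct.add_tmul, hy, hz]
      | tmul u v => simp
  exact (hl _).trans (key.trans (hr _).symm)

lemma counit_α (T : HomTC k G H) (x : H 1) : T.counit (T.α 1 x) = T.counit x := by
  rw [← T.ax.counit_αinv, LinearEquiv.symm_apply_apply]

lemma counit_untwistComul (T : HomTC k G H) {a : G} (h : a = 1 * a) (x : H a) :
    TensorProduct.lid k (H a)
      (TensorProduct.map T.counit LinearMap.id (T.untwistComul h x)) = x := by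
  have key : ∀ y : H 1 ⊗[k] H a, TensorProduct.lid k (H a)
      (TensorProduct.map T.counit LinearMap.id
        (TensorProduct.map (T.α 1).toLinearMap (T.α a).toLinearMap y))
      = T.α a (TensorProduct.lid k (H a) (TensorProduct.map T.counit LinearMap.id y)) := by
    intro y
    induction y using TensorProduct.induction_on with
    | zero => simp
    | add y z hy hz => simp only [map_add, hy, hz]
    | tmul u v => simp [counit_α]
  exact (key _).trans ((congrArg _ (T.ax.counit_comul' a x)).trans (by simp))

lemma untwistComul_counit (T : HomTC k G H) {a : G} (h : a = a * 1) (x : H a) :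
    TensorProduct.rid k (H a)
      (TensorProduct.map LinearMap.id T.counit (T.untwistComul h x)) = x := by
  have key : ∀ y : H a ⊗[k] H 1, TensorProduct.rid k (H a)
      (TensorProduct.map LinearMap.id T.counit
        (TensorProduct.map (T.α a).toLinearMap (T.α 1).toLinearMap y))
      = T.α a (TensorProduct.rid k (H a) (TensorProduct.map LinearMap.id T.counit y)) := by
    intro y
    induction y using TensorProduct.induction_on with
    | zero => simp
    | add y z hy hz => simp only [map_add, hy, hz]
    | tmul u v => simp [counit_α]
  exact (key _).trans ((congrArg _ (T.ax.comul_counit' a x)).trans (by simp))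

lemma untwist_antipode_left (T : HomTC k G H) (a : G) (h : (1 : G) = a⁻¹ * a) (x : H 1) :
    TensorProduct.lift (T.untwistMul a)
      (TensorProduct.map (T.antipodeTo (inv_inv a)) LinearMap.id (T.untwistComul h x))
    = T.counit x • T.one a := by
  have key : ∀ y : H a⁻¹ ⊗[k] H a, TensorProduct.lift (T.untwistMul a)
      (TensorProduct.map (T.antipodeTo (inv_inv a)) LinearMap.id
        (TensorProduct.map (T.α a⁻¹).toLinearMap (T.α a).toLinearMap y))
      = TensorProduct.lift (T.mul a)
      (TensorProduct.map (T.antipodeTo (inv_inv a)) LinearMap.id y) := by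
    intro y
    induction y using TensorProduct.induction_on with
    | zero => simp
    | add y z hy hz => simp only [map_add, hy, hz]
    | tmul u v => simp [antipodeTo_α, ← T.ax.α_mul]
  exact (key _).trans (T.ax.antipode_left a x)

lemma untwist_antipode_right (T : HomTC k G H) (a : G) (h : (1 : G) = a * a⁻¹) (x : H 1) :
    TensorProduct.lift (T.untwistMul a)
      (TensorProduct.map LinearMap.id (T.antipodeTo (inv_inv a)) (T.untwistComul h x))
    = T.counit x • T.one a := by
  have key : ∀ y : H a ⊗[k] H a⁻¹, TensorProduct.lift (T.untwistMul a)
      (TensorProduct.map LinearMap.id (T.antipodeTo (inv_inv a))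
        (TensorProduct.map (T.α a).toLinearMap (T.α a⁻¹).toLinearMap y))
      = TensorProduct.lift (T.mul a)
      (TensorProduct.map LinearMap.id (T.antipodeTo (inv_inv a)) y) := by
    intro y
    induction y using TensorProduct.induction_on with
    | zero => simp
    | add y z hy hz => simp only [map_add, hy, hz]
    | tmul u v => simp [antipodeTo_α, ← T.ax.α_mul]
  exact (key _).trans (T.ax.antipode_right a x)

end HomTC

namespace IsYD

variable {T : HomTC k G H} {p : G} {M : Type*} [AddCommGroup M] [Module k M]
  {μ : M ≃ₗ[k] M} {act : H p →ₗ[k] M →ₗ[k] M} {ρ : ∀ r : G, M →ₗ[k] M ⊗[k] H r}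

/-- The untwisted action. -/
def untwistAct (μ : M ≃ₗ[k] M) (act : H p →ₗ[k] M →ₗ[k] M) : H p →ₗ[k] M →ₗ[k] M :=
  act.compr₂ μ.symm.toLinearMap

omit [Group G] in
@[simp]
lemma untwistAct_apply (μ : M ≃ₗ[k] M) (act : H p →ₗ[k] M →ₗ[k] M) (h : H p) (m : M) :
    untwistAct μ act h m = μ.symm (act h m) := rfl

/-- The untwisted coaction. -/
def untwistCoact (T : HomTC k G H) (μ : M ≃ₗ[k] M) (ρ : ∀ r : G, M →ₗ[k] M ⊗[k] H r) (r : G) :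
    M →ₗ[k] M ⊗[k] H r :=
  (TensorProduct.map μ.toLinearMap (T.α r).toLinearMap).comp (ρ r)

lemma μ_symm_act_α (hM : IsYD k T p μ act ρ) (h : H p) (m : M) :
    μ.symm (act (T.α p h) m) = act h (μ.symm m) := by
  rw [LinearEquiv.symm_apply_eq, hM.μ_act, LinearEquiv.apply_symm_apply]

lemma coact_μ (hM : IsYD k T p μ act ρ) (r : G) (m : M) :
    ρ r (μ m) = TensorProduct.map μ.toLinearMap (T.α r).toLinearMap (ρ r m) :=
  LinearMap.congr_fun (hM.ρ_μ r) m

lemma untwistAct_mul (hM : IsYD k T p μ act ρ) (a b : H p) (m : M) :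
    untwistAct μ act (T.untwistMul p a b) m = untwistAct μ act a (untwistAct μ act b m) := by
  have h := hM.μ_symm_act_α ((T.α p).symm (T.mul p a b)) (μ m)
  rw [LinearEquiv.apply_symm_apply, LinearEquiv.symm_apply_apply, ← hM.act_act,
    hM.μ_symm_act_α] at h
  simp [h]

lemma untwistAct_one (hM : IsYD k T p μ act ρ) (m : M) :
    untwistAct μ act (T.one p) m = m := by
  simp [hM.act_one]

lemma untwistCoact_coassoc (hM : IsYD k T p μ act ρ) {a b c : G} (h : c = a * b) (m : M) :
    TensorProduct.map LinearMap.id (T.untwistComul h) (untwistCoact T μ ρ c m)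
      = TensorProduct.assoc k M (H a) (H b) (TensorProduct.map (untwistCoact T μ ρ a) LinearMap.id
          (untwistCoact T μ ρ b m)) := by
  subst h
  have key := congrArg (TensorProduct.map (μ.toLinearMap.comp μ.toLinearMap)
    (TensorProduct.map ((T.α a).toLinearMap.comp (T.α a).toLinearMap)
      ((T.α b).toLinearMap.comp (T.α b).toLinearMap)))
    (LinearMap.congr_fun (hM.ρ_coassoc a b) m)
  simp only [LinearMap.comp_apply] at key
  have hl : ∀ y : M ⊗[k] H (a * b),
      TensorProduct.map LinearMap.id (T.untwistComul rfl)
        (TensorProduct.map μ.toLinearMap (T.α (a * b)).toLinearMap y)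
      = TensorProduct.map (μ.toLinearMap.comp μ.toLinearMap)
    (TensorProduct.map ((T.α a).toLinearMap.comp (T.α a).toLinearMap)
      ((T.α b).toLinearMap.comp (T.α b).toLinearMap))
        (TensorProduct.map μ.symm.toLinearMap (T.comul a b) y) := by
    intro y
    induction y using TensorProduct.induction_on with
    | zero => simp
    | add y z hy hz => simp only [map_add, hy, hz]
    | tmul u v =>
      simp only [TensorProduct.map_tmul, HomTC.untwistComul, LinearMap.comp_apply, cst_self,
        LinearEquiv.coe_coe, HomTC.comul_α, LinearMap.id_apply, TensorProduct.map_comp,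
        LinearEquiv.apply_symm_apply]
  have hr : ∀ y : M ⊗[k] H b,
      TensorProduct.assoc k M (H a) (H b)
        (TensorProduct.map (untwistCoact T μ ρ a) LinearMap.id
        (TensorProduct.map μ.toLinearMap (T.α b).toLinearMap y))
      = TensorProduct.map (μ.toLinearMap.comp μ.toLinearMap)
    (TensorProduct.map ((T.α a).toLinearMap.comp (T.α a).toLinearMap)
      ((T.α b).toLinearMap.comp (T.α b).toLinearMap))
        (TensorProduct.assoc k M (H a) (H b)
          (TensorProduct.map (ρ a) (T.α b).symm.toLinearMap y)) := by
    intro y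
    induction y using TensorProduct.induction_on with
    | zero => simp
    | add y z hy hz => simp only [map_add, hy, hz]
    | tmul u v =>
      simp only [TensorProduct.map_tmul, untwistCoact, LinearMap.comp_apply,
        LinearEquiv.coe_coe, hM.coact_μ, LinearMap.id_apply]
      generalize ρ a u = w
      induction w using TensorProduct.induction_on with
      | zero => simp
      | add y z hy hz => simp only [map_add, TensorProduct.add_tmul, hy, hz]
      | tmul u v => simp
  exact (hl _).trans (key.trans (hr _).symm)

lemma untwist_compat (hM : IsYD k T p μ act ρ) (r : G) (h₁ : p * r = p * r)
    (h₂ : p * r = p * r * p⁻¹ * p) (h₃ : p⁻¹ * (p * r * p⁻¹) * p⁻¹⁻¹ = r)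
    (e : H (p * r)) (m : M) :
    TensorProduct.map₂ (untwistAct μ act) (T.untwistMul r) (T.untwistComul h₁ e)
        (untwistCoact T μ ρ r m)
      = TensorProduct.lift (compBilin (rightOp M (T.untwistMul r) (T.conj p⁻¹ h₃))
          ((untwistAct μ act).compr₂ (untwistCoact T μ ρ r))) (T.untwistComul h₂ e) m := by
  have key := LinearMap.congr_fun (hM.compat r) (e ⊗ₜ m)
  simp only [LinearMap.comp_apply, TensorProduct.map_tmul] at key
  have hl : ∀ (x : H p ⊗[k] H r) (y : M ⊗[k] H r),
      TensorProduct.map₂ (untwistAct μ act) (T.untwistMul r)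
        (TensorProduct.map (T.α p).toLinearMap (T.α r).toLinearMap x)
        (TensorProduct.map μ.toLinearMap (T.α r).toLinearMap y)
      = TensorProduct.map (TensorProduct.lift act) (TensorProduct.lift (T.mul r))
          (TensorProduct.tensorTensorTensorComm k (H p) (H r) M (H r) (x ⊗ₜ y)) := by
    intro x y
    induction x using TensorProduct.induction_on with
    | zero => simp
    | add x z hx hz => simp only [map_add, TensorProduct.add_tmul, LinearMap.add_apply, hx, hz]
    | tmul u v =>
      induction y using TensorProduct.induction_on with
      | zero => simp
      | add x z hx hz => simp only [map_add, TensorProduct.tmul_add, hx, hz]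
      | tmul m b => simp [hM.μ_symm_act_α, ← T.ax.α_mul]
  have hr : ∀ (x : H (p * r * p⁻¹) ⊗[k] H p),
      TensorProduct.lift (compBilin (rightOp M (T.untwistMul r) (T.conj p⁻¹ h₃))
          ((untwistAct μ act).compr₂ (untwistCoact T μ ρ r)))
        (TensorProduct.map (T.α _).toLinearMap (T.α p).toLinearMap x) m
      = TensorProduct.map μ.toLinearMap (TensorProduct.lift (T.mul r))
          (TensorProduct.assoc k M (H r) (H r)
            (TensorProduct.comm k (H r) (M ⊗[k] H r)
              (TensorProduct.map (T.conj p⁻¹ h₃) ((ρ r).comp (TensorProduct.lift act))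
                (TensorProduct.assoc k (H (p * r * p⁻¹)) (H p) M (x ⊗ₜ μ.symm m))))) := by
    intro x
    induction x using TensorProduct.induction_on with
    | zero => simp
    | add x z hx hz => simp only [map_add, TensorProduct.add_tmul, LinearMap.add_apply, hx, hz]
    | tmul u v =>
      simp only [TensorProduct.map_tmul, TensorProduct.lift.tmul, compBilin_apply,
        TensorProduct.assoc_tmul, LinearMap.comp_apply, LinearMap.compr₂_apply, untwistCoact,
        untwistAct_apply, LinearEquiv.coe_coe, hM.μ_symm_act_α, TensorProduct.comm_tmul]
      generalize ρ r (act v (μ.symm m)) = w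
      induction w using TensorProduct.induction_on with
      | zero => simp
      | add x z hx hz => simp only [map_add, TensorProduct.add_tmul, hx, hz]
      | tmul m b => simp [HomTC.conj_α, ← T.ax.α_mul]
  exact (hl _ _).trans (key.trans (hr _).symm)

end IsYD

lemma map_plainCoact {B D X Y : Type*} [AddCommGroup B] [Module k B] [AddCommGroup D] [Module k D]
    [AddCommGroup X] [Module k X] [AddCommGroup Y] [Module k Y]
    (mul : B →ₗ[k] B →ₗ[k] B) (π : D →ₗ[k] B) (ρX : X →ₗ[k] X ⊗[k] D)
    (ρY : Y →ₗ[k] Y ⊗[k] B) (f : X →ₗ[k] X) (g : Y →ₗ[k] Y) (β : B ≃ₗ[k] B) (δ : D →ₗ[k] D)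
    (hπ : ∀ d, π (δ d) = β (π d)) (hmul : ∀ a b, β (mul a b) = mul (β a) (β b)) :
    (TensorProduct.map (TensorProduct.map f g) LinearMap.id).comp (plainCoact mul π ρX ρY)
      = plainCoact (mul.compr₂ β.symm.toLinearMap) π ((TensorProduct.map f δ).comp ρX)
          ((TensorProduct.map g β.toLinearMap).comp ρY) := by
  refine TensorProduct.ext' fun x y => ?_
  simp only [plainCoact, LinearMap.comp_apply, TensorProduct.map_tmul]
  generalize ρX x = u
  generalize ρY y = v
  induction u using TensorProduct.induction_on with
  | zero => simp
  | add x z hx hz => simp only [map_add, TensorProduct.add_tmul, hx, hz]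
  | tmul x d =>
    induction v using TensorProduct.induction_on with
    | zero => simp
    | add x z hx hz => simp only [map_add, TensorProduct.tmul_add, hx, hz]
    | tmul y b => simp [hπ, ← hmul]

lemma tCoact_eq_plainCoact (T : HomTC k G H) (b : G) {M N : Type*} [AddCommGroup M] [Module k M]
    [AddCommGroup N] [Module k N]
    (ρM : ∀ r : G, M →ₗ[k] M ⊗[k] H r) (ρN : ∀ r : G, N →ₗ[k] N ⊗[k] H r) (r : G)
    (h : b⁻¹ * (b * r * b⁻¹) * b⁻¹⁻¹ = r) :
    tCoact k T b ρM ρN r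
      = plainCoact (T.mul r) (T.conj b⁻¹ h) (ρM (b * r * b⁻¹)) (ρN r) := rfl

omit [Group G] in
lemma map_cst_coact {N : Type*} [AddCommGroup N] [Module k N]
    (ρN : ∀ r : G, N →ₗ[k] N ⊗[k] H r) {a b : G} (h : a = b) (n : N) :
    TensorProduct.map LinearMap.id (cst k h) (ρN a n) = ρN b n := by
  subst h
  exact LinearMap.congr_fun TensorProduct.map_id _

lemma tCoact_cCoact (T : HomTC k G H) (p : G) {M N : Type*} [AddCommGroup M] [Module k M]
    [AddCommGroup N] [Module k N]
    (ρM : ∀ r : G, M →ₗ[k] M ⊗[k] H r) (ρN : ∀ r : G, N →ₗ[k] N ⊗[k] H r) (r : G) :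
    tCoact k T p (cCoact k T p ρN) ρM r
      = plainCoact (T.mul r) LinearMap.id (ρN r) (ρM r) := by
  have hr : p⁻¹ * (p * r * p⁻¹) * p = r := by group
  refine TensorProduct.ext' fun n m => ?_
  rw [tCoact_eq_plainCoact T p _ _ r (by group)]
  simp only [plainCoact, LinearMap.comp_apply, TensorProduct.map_tmul, cCoact]
  rw [← map_cst_coact ρN hr n]
  generalize ρN _ n = u
  generalize ρM r m = v
  induction u using TensorProduct.induction_on with
  | zero => simp
  | add x z hx hz => simp only [map_add, TensorProduct.add_tmul, hx, hz]
  | tmul x d =>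
    induction v using TensorProduct.induction_on with
    | zero => simp
    | add x z hx hz => simp only [map_add, TensorProduct.tmul_add, hx, hz]
    | tmul y b =>
      have := T.conj_inv_conj p (a := p⁻¹ * (p * r * p⁻¹) * p) (b := p * r * p⁻¹) (c := r)
        (by group) (by group) hr d
      simp only [TensorProduct.map_tmul]
      rw [← this]
      rfl

lemma braid_eq_plainBraid (T : HomTC k G H) {q : G} {M N : Type*} [AddCommGroup M] [Module k M]
    [AddCommGroup N] [Module k N] (μ : M ≃ₗ[k] M) (ρM : ∀ r : G, M →ₗ[k] M ⊗[k] H r)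
    {ν : N ≃ₗ[k] N} {actN : H q →ₗ[k] N →ₗ[k] N} {ρN : ∀ r : G, N →ₗ[k] N ⊗[k] H r}
    (hN : IsYD k T q ν actN ρN) :
    braid k T q μ ρM actN ν
      = plainBraid (IsYD.untwistAct ν actN) (T.antipodeTo (inv_inv q))
          (IsYD.untwistCoact T μ ρM q⁻¹) := by
  refine TensorProduct.ext' fun m n => ?_
  simp only [braid, plainBraid, IsYD.untwistCoact, LinearMap.comp_apply, TensorProduct.map_tmul]
  generalize ρM q⁻¹ m = u
  induction u using TensorProduct.induction_on with
  | zero => simp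
  | add x z hx hz => simp only [map_add, TensorProduct.add_tmul, hx, hz]
  | tmul x d =>
    simp [HomTC.antipodeTo_α, hN.μ_symm_act_α]
    rfl

lemma braid_comp_map (T : HomTC k G H) {p q : G} {M N : Type*} [AddCommGroup M] [Module k M]
    [AddCommGroup N] [Module k N] {μ : M ≃ₗ[k] M} {actM : H p →ₗ[k] M →ₗ[k] M}
    {ρM : ∀ r : G, M →ₗ[k] M ⊗[k] H r}
    {ν : N ≃ₗ[k] N} {actN : H q →ₗ[k] N →ₗ[k] N} {ρN : ∀ r : G, N →ₗ[k] N ⊗[k] H r}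
    (hM : IsYD k T p μ actM ρM) (hN : IsYD k T q ν actN ρN) :
    (braid k T q μ ρM actN ν).comp (TensorProduct.map μ.toLinearMap ν.toLinearMap)
      = (TensorProduct.map ν.toLinearMap μ.toLinearMap).comp (braid k T q μ ρM actN ν) := by
  refine TensorProduct.ext' fun m n => ?_
  simp only [braid, LinearMap.comp_apply, TensorProduct.map_tmul, LinearEquiv.coe_coe, hM.coact_μ]
  generalize ρM q⁻¹ m = u
  induction u using TensorProduct.induction_on with
  | zero => simp
  | add x z hx hz => simp only [map_add, TensorProduct.add_tmul, hx, hz]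
  | tmul x d =>
    have := T.antipodeTo_α (inv_inv q) d
    simp only [HomTC.antipodeTo, LinearMap.comp_apply, LinearEquiv.coe_coe] at this
    simp [hN.μ_act, this]

end Twist

/-- The braiding `c_{M,N}` is `H`-colinear. -/
theorem statement13 {k : Type*} [Field k] {G : Type*} [Group G] {H : G → Type*}
    [∀ p, AddCommGroup (H p)] [∀ p, Module k (H p)]
    (T : HomTC k G H) (p q : G)
    (M : Type*) [AddCommGroup M] [Module k M] (N : Type*) [AddCommGroup N] [Module k N]
    (μ : M ≃ₗ[k] M) (actM : H p →ₗ[k] M →ₗ[k] M) (ρM : ∀ r : G, M →ₗ[k] M ⊗[k] H r)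
    (ν : N ≃ₗ[k] N) (actN : H q →ₗ[k] N →ₗ[k] N) (ρN : ∀ r : G, N →ₗ[k] N ⊗[k] H r)
    (hM : IsYD k T p μ actM ρM) (hN : IsYD k T q ν actN ρN) :
    ∀ r : G,
      (tCoact k T p (cCoact k T p ρN) ρM r).comp (braid k T q μ ρM actN ν)
        = (TensorProduct.map (braid k T q μ ρM actN ν) LinearMap.id).comp
            (tCoact k T q ρM ρN r) := by
  intro r
  have hLast := plainCoact_plainBraid (T.untwistMul r) (IsYD.untwistAct ν actN)
    (IsYD.untwistCoact T ν ρN r) (T.conj q⁻¹ (a := q * r * q⁻¹) (b := r) (by group))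
    (T.antipodeTo (inv_inv q))
    (T.untwistComul (a := q⁻¹) (b := q * r * q⁻¹) (c := r * q⁻¹) (by group))
    (T.untwistComul (a := r) (b := q⁻¹) (c := r * q⁻¹) rfl)
    (IsYD.untwistCoact T μ ρM r) (IsYD.untwistCoact T μ ρM q⁻¹)
    (IsYD.untwistCoact T μ ρM (q * r * q⁻¹)) (IsYD.untwistCoact T μ ρM (r * q⁻¹))
    (leftOp_coact_antipode (T.untwistMul q) (T.one q) (T.untwistMul r) _ _ _ _ T.counit
      (T.untwistComul (a := q) (b := r) rfl)
      (T.untwistComul (a := q * r) (b := q⁻¹) rfl)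
      (T.untwistComul (a := q⁻¹) (b := q) (by group))
      (T.untwistComul (a := 1) (b := r) (by group))
      (T.untwistComul (a := q⁻¹) (b := q * r) (by group)) _ _
      hN.untwistAct_mul hN.untwistAct_one
      (map₂_coact_antipode (T.untwistMul q) (T.one q) (T.untwistMul r) _ _ _ _ T.counit
        (T.untwistComul (a := q) (b := r) rfl)
        (T.untwistComul (a := q * r * q⁻¹) (b := q) (by group))
        (T.untwistComul (a := q * r) (b := q⁻¹) rfl)
        (T.untwistComul (a := q * r * q⁻¹) (b := 1) (by group))
        (T.untwistComul (a := q) (b := q⁻¹) (by group))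
        hN.untwistAct_mul hN.untwistAct_one
        (hN.untwist_compat r _ _ _) (T.untwistComul_coassoc _ _ _ _)
        (T.untwistComul_counit _) (T.untwist_antipode_right q _))
      (T.untwistComul_coassoc _ _ _ _) (T.untwistComul_coassoc _ _ _ _)
      (T.counit_untwistComul _) (T.untwist_antipode_left q _))
    (hM.untwistCoact_coassoc _) (hM.untwistCoact_coassoc _)
  have hL := map_plainCoact (T.mul r) LinearMap.id (ρN r) (ρM r) ν.toLinearMap μ.toLinearMap
    (T.α r) (T.α r).toLinearMap (fun _ => rfl) (T.ax.α_mul r)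
  have hR := map_plainCoact (T.mul r) (T.conj q⁻¹ (a := q * r * q⁻¹) (b := r) (by group))
    (ρM (q * r * q⁻¹)) (ρN r) μ.toLinearMap ν.toLinearMap
    (T.α r) (T.α _).toLinearMap (T.conj_α _ _) (T.ax.α_mul r)
  rw [← braid_eq_plainBraid T μ ρM hN] at hLast
  have inj : Function.Injective
      (TensorProduct.map (TensorProduct.map ν.toLinearMap μ.toLinearMap)
        (LinearMap.id : H r →ₗ[k] H r)) :=
    (TensorProduct.congr (TensorProduct.congr ν μ) (LinearEquiv.refl k (H r))).injective
  refine LinearMap.ext fun x => inj ?_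
  rw [tCoact_cCoact, tCoact_eq_plainCoact T q ρM ρN r (by group)]
  simp only [← LinearMap.comp_apply]
  refine LinearMap.congr_fun ?_ x
  calc _ = _ := congrArg (fun f => f.comp (braid k T q μ ρM actN ν)) hL
    _ = _ := hLast
    _ = _ := congrArg (fun f => (TensorProduct.map (braid k T q μ ρM actN ν) LinearMap.id).comp f)
      hR.symm
    _ = _ := by
      rw [← LinearMap.comp_assoc, ← LinearMap.comp_assoc, ← TensorProduct.map_comp,
        ← TensorProduct.map_comp, braid_comp_map T hM hN]
end
end

section
/- Let (H, α) be a monoidal Hom-Hopf T-coalgebra over G with bijective antipode, (M, μ) ∈ YD_p, (N, ν) ∈ YD_q, and s ∈ G. Then the braiding commutes with conjugation: c_{^sM,^sN}(^sm ⊗ ^sn) = ^s(c_{M,N}(m ⊗ n)) for all m ∈ M, n ∈ N, i.e. c_{^sM,^sN} = ^s(·) ∘ c_{M,N} under the identification ^s(^MN ⊗ M) = ^{^sM}(^sN) ⊗ ^sM. -/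
open TensorProduct

noncomputable section

namespace HomTC

variable {k : Type*} [Field k] {G : Type*} [Group G] {H : G → Type*}
  [∀ p, AddCommGroup (H p)] [∀ p, Module k (H p)]

/-- Comultiplication on a component whose degree is only propositionally a product. -/
def comulOf (T : HomTC k G H) (a b c : G) (h : c = a * b) : H c →ₗ[k] H a ⊗[k] H b :=
  (T.comul a b).comp (cst k h)

/-- Counit on a component whose degree is only propositionally the unit. -/
def counitOf (T : HomTC k G H) (e : G) (h : e = 1) : H e →ₗ[k] k :=
  T.counit.comp (cst k h)

/-- Antipode with values in a component whose degree is propositionally the inverse. -/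
def antipodeOf (T : HomTC k G H) (a b : G) (h : a⁻¹ = b) : H a →ₗ[k] H b :=
  (cst k h).comp (T.antipode a).toLinearMap

/-- Crossing with values in a component whose degree is propositionally the conjugate. -/
def crossOf (T : HomTC k G H) (q a b : G) (h : q * a * q⁻¹ = b) : H a →ₗ[k] H b :=
  (cst k h).comp (T.π q a).toLinearMap

variable (T : HomTC k G H)

theorem hcoassocOf {a b c ab bc d : G} (hab : ab = a * b) (hbc : bc = b * c)
    (h₁ : d = a * bc) (h₂ : d = ab * c) (x : H d) :
    TensorProduct.map (T.α a).symm.toLinearMap (T.comulOf b c bc hbc) (T.comulOf a bc d h₁ x)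
      = TensorProduct.assoc k (H a) (H b) (H c)
          (TensorProduct.map (T.comulOf a b ab hab) (T.α c).symm.toLinearMap
            (T.comulOf ab c d h₂ x)) := by
  subst hab hbc h₂
  exact LinearMap.congr_fun (T.ax.hcoassoc a b c) x

theorem counit_comulOf {e a b : G} (he : e = 1) (h : b = e * a) (hab : b = a) (x : H b) :
    TensorProduct.lid k (H a)
      (TensorProduct.map (T.counitOf e he) LinearMap.id (T.comulOf e a b h x))
      = (T.α a).symm (cst k hab x) := by
  subst he hab
  exact T.ax.counit_comul' b x

theorem comulOf_counit {e a b : G} (he : e = 1) (h : b = a * e) (hab : b = a) (x : H b) :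
    TensorProduct.rid k (H a)
      (TensorProduct.map LinearMap.id (T.counitOf e he) (T.comulOf a e b h x))
      = (T.α a).symm (cst k hab x) := by
  subst he hab
  exact T.ax.comul_counit' b x

theorem antipodeOf_α {a b : G} (h : a⁻¹ = b) (x : H a) :
    T.antipodeOf a b h (T.α a x) = T.α b (T.antipodeOf a b h x) := by
  subst h
  exact T.ax.antipode_α a x

theorem antipodeOf_left {a b e : G} (hab : a⁻¹ = b) (he : e = 1) (h : e = a * b) (x : H e) :
    TensorProduct.lift (T.mul b)
      (TensorProduct.map (T.antipodeOf a b hab) LinearMap.id (T.comulOf a b e h x))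
      = T.counitOf e he x • T.one b := by
  obtain rfl : a = b⁻¹ := by rw [← hab, inv_inv]
  subst he
  exact T.ax.antipode_left b x

theorem antipodeOf_right {a b e : G} (hab : a⁻¹ = b) (he : e = 1) (h : e = b * a) (x : H e) :
    TensorProduct.lift (T.mul b)
      (TensorProduct.map LinearMap.id (T.antipodeOf a b hab) (T.comulOf b a e h x))
      = T.counitOf e he x • T.one b := by
  obtain rfl : a = b⁻¹ := by rw [← hab, inv_inv]
  subst he
  exact T.ax.antipode_right b x

theorem crossOf_mul {q a b : G} (h : q * a * q⁻¹ = b) (x y : H a) :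
    T.crossOf q a b h (T.mul a x y) = T.mul b (T.crossOf q a b h x) (T.crossOf q a b h y) := by
  subst h
  exact T.cax.π_mul q a x y

theorem crossOf_one {q a b : G} (h : q * a * q⁻¹ = b) :
    T.crossOf q a b h (T.one a) = T.one b := by
  subst h
  exact T.cax.π_one q a

theorem crossOf_α {q a b : G} (h : q * a * q⁻¹ = b) (x : H a) :
    T.crossOf q a b h (T.α a x) = T.α b (T.crossOf q a b h x) := by
  subst h
  exact T.cax.π_α q a x

theorem crossOf_comul {q a b c a' b' c' : G} (ha : q * a * q⁻¹ = a') (hb : q * b * q⁻¹ = b')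
    (hc : q * c * q⁻¹ = c') (h : c = a * b) (h' : c' = a' * b') (x : H c) :
    TensorProduct.map (T.crossOf q a a' ha) (T.crossOf q b b' hb) (T.comulOf a b c h x)
      = T.comulOf a' b' c' h' (T.crossOf q c c' hc x) := by
  subst ha hb hc h
  exact T.cax.π_comul q a b x

theorem crossOf_counit {q e e' : G} (he : e = 1) (he' : e' = 1) (h : q * e * q⁻¹ = e')
    (x : H e) : T.counitOf e' he' (T.crossOf q e e' h x) = T.counitOf e he x := by
  subst he he'
  exact T.cax.π_counit q x

theorem crossOf_crossOf {a b c x y z : G} (hc : a * b = c) (hy : b * x * b⁻¹ = y)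
    (hz : a * y * a⁻¹ = z) (h : c * x * c⁻¹ = z) (m : H x) :
    T.crossOf a y z hz (T.crossOf b x y hy m) = T.crossOf c x z h m := by
  subst hc hy hz
  exact (T.cax.π_mult a b x m).symm

theorem crossOf_injective {q a b : G} (h : q * a * q⁻¹ = b) :
    Function.Injective (T.crossOf q a b h) := by
  subst h
  exact (T.π q a).injective

theorem crossOf_unit {e x : G} (he : e = 1) (h : e * x * e⁻¹ = x) (m : H x) :
    T.crossOf e x x h m = m :=
  T.crossOf_injective h (T.crossOf_crossOf (by simp [he]) h h h m)

theorem crossOf_inv_crossOf {q r a b : G} (hr : r * q = 1) (h : q * a * q⁻¹ = b)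
    (h' : r * b * r⁻¹ = a) (x : H a) :
    T.crossOf r b a h' (T.crossOf q a b h x) = x := by
  rw [T.crossOf_crossOf hr h h' (by group), T.crossOf_unit rfl]

/-- A left convolution inverse commuting with the twist agrees with a right one. -/
theorem convInverse_unique {a b : G} (hab : a * b = 1) (hba : b * a = 1)
    (f g : H a →ₗ[k] H b) (hfα : ∀ x, f (T.α a x) = T.α b (f x))
    (hgα : ∀ x, g (T.α a x) = T.α b (g x))
    (hf : ∀ x : H (1 : G), TensorProduct.lift (T.mul b)
      (TensorProduct.map f LinearMap.id (T.comulOf a b 1 hab.symm x))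
      = T.counitOf 1 rfl x • T.one b)
    (hg : ∀ x : H (1 : G), TensorProduct.lift (T.mul b)
      (TensorProduct.map LinearMap.id g (T.comulOf b a 1 hba.symm x))
      = T.counitOf 1 rfl x • T.one b) : f = g := by
  ext c
  have key := congrArg
    (TensorProduct.lift (T.mul b) ∘ₗ
      TensorProduct.map ((T.α b).toLinearMap ∘ₗ f)
        (TensorProduct.lift (T.mul b) ∘ₗ TensorProduct.map LinearMap.id g))
    (T.hcoassocOf hab.symm hba.symm (mul_one a).symm (one_mul a).symm c)
  have hL : ∀ t : H a ⊗[k] H (1 : G),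
      (TensorProduct.lift (T.mul b) ∘ₗ
        TensorProduct.map ((T.α b).toLinearMap ∘ₗ f)
          (TensorProduct.lift (T.mul b) ∘ₗ TensorProduct.map LinearMap.id g))
        (TensorProduct.map (T.α a).symm.toLinearMap (T.comulOf b a 1 hba.symm) t)
      = T.α b (f (TensorProduct.rid k (H a)
          (TensorProduct.map LinearMap.id (T.counitOf 1 rfl) t))) := by
    intro t
    induction t with
    | zero => simp
    | add x y hx hy => simp only [map_add, hx, hy]
    | tmul x y => simp [hg, ← hfα, T.ax.mul_one']
  have hR : ∀ t : H (1 : G) ⊗[k] H a,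
      (TensorProduct.lift (T.mul b) ∘ₗ
        TensorProduct.map ((T.α b).toLinearMap ∘ₗ f)
          (TensorProduct.lift (T.mul b) ∘ₗ TensorProduct.map LinearMap.id g))
        (TensorProduct.assoc k (H a) (H b) (H a)
          (TensorProduct.map (T.comulOf a b 1 hab.symm) (T.α a).symm.toLinearMap t))
      = T.α b (g (TensorProduct.lid k (H a)
          (TensorProduct.map (T.counitOf 1 rfl) LinearMap.id t))) := by
    intro t
    induction t with
    | zero => simp
    | add x y hx hy => simp only [map_add, hx, hy]
    | tmul x y =>
      have hA : ∀ (u : H a ⊗[k] H b) (z : H a),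
          (TensorProduct.lift (T.mul b) ∘ₗ
            TensorProduct.map ((T.α b).toLinearMap ∘ₗ f)
              (TensorProduct.lift (T.mul b) ∘ₗ TensorProduct.map LinearMap.id g))
            (TensorProduct.assoc k (H a) (H b) (H a) (u ⊗ₜ z))
          = T.mul b (TensorProduct.lift (T.mul b) (TensorProduct.map f LinearMap.id u))
              (T.α b (g z)) := by
        intro u z
        induction u with
        | zero => simp
        | add x y hx hy => simp only [TensorProduct.add_tmul, map_add, hx, hy, LinearMap.add_apply]
        | tmul x y => simp [T.ax.hom_assoc]
      rw [TensorProduct.map_tmul, hA, hf]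
      simp [← hgα, T.ax.one_mul']
  rw [hL, hR, T.comulOf_counit rfl _ rfl, T.counit_comulOf rfl _ rfl, ← hfα, ← hgα] at key
  simpa [cst] using key

/-- The antipode commutes with the crossing. -/
theorem antipodeOf_crossOf {q a b a' b' : G} (hab : a⁻¹ = b) (hab' : a'⁻¹ = b')
    (ha : q * a * q⁻¹ = a') (hb : q * b * q⁻¹ = b') (x : H a) :
    T.antipodeOf a' b' hab' (T.crossOf q a a' ha x)
      = T.crossOf q b b' hb (T.antipodeOf a b hab x) := by
  have hb' : q⁻¹ * b' * q⁻¹⁻¹ = b := by rw [← hb]; group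
  have hm : a * b = 1 := by rw [← hab, mul_inv_cancel]
  have hm' : b * a = 1 := by rw [← hab, inv_mul_cancel]
  have hn : (1 : G) = a' * b' := by rw [← hab', mul_inv_cancel]
  have hone : q * 1 * q⁻¹ = 1 := by group
  have hcross : T.crossOf q⁻¹ b' b hb' ∘ₗ T.antipodeOf a' b' hab' ∘ₗ T.crossOf q a a' ha
      = T.antipodeOf a b hab := by
    refine T.convInverse_unique hm hm' _ _ ?_ (T.antipodeOf_α hab) ?_
      (T.antipodeOf_right hab rfl hm'.symm)
    · intro y
      simp [crossOf_α, antipodeOf_α]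
    · intro y
      have hmap : ∀ t : H a ⊗[k] H b,
          TensorProduct.lift (T.mul b)
            (TensorProduct.map (T.crossOf q⁻¹ b' b hb' ∘ₗ T.antipodeOf a' b' hab' ∘ₗ
              T.crossOf q a a' ha) LinearMap.id t)
          = T.crossOf q⁻¹ b' b hb' (TensorProduct.lift (T.mul b')
              (TensorProduct.map (T.antipodeOf a' b' hab') LinearMap.id
                (TensorProduct.map (T.crossOf q a a' ha) (T.crossOf q b b' hb) t))) := by
        intro t
        induction t with
        | zero => simp
        | add x y hx hy => simp only [map_add, hx, hy]
        | tmul x y =>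
          simp [crossOf_mul, T.crossOf_inv_crossOf (inv_mul_cancel q) hb hb']
      rw [hmap, T.crossOf_comul ha hb hone hm.symm hn, T.antipodeOf_left hab' rfl hn, map_smul,
        T.crossOf_one, T.crossOf_counit rfl rfl]
  rw [← hcross]
  exact (T.crossOf_inv_crossOf (mul_inv_cancel q) hb' hb _).symm

theorem cCoact_eq {s r r' : G} (h : r' = s⁻¹ * r * s) (h' : s * r' * s⁻¹ = r)
    {M : Type*} [AddCommGroup M] [Module k M] (ρ : ∀ r : G, M →ₗ[k] M ⊗[k] H r) :
    cCoact k T s ρ r = (TensorProduct.map LinearMap.id (T.crossOf s r' r h')).comp (ρ r') := by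
  subst h
  rfl

end HomTC

/-- The braiding commutes with conjugation: `c_{ˢM,ˢN} = ˢ(·) ∘ c_{M,N}`. -/
theorem statement16 {k : Type*} [Field k] {G : Type*} [Group G] {H : G → Type*}
    [∀ p, AddCommGroup (H p)] [∀ p, Module k (H p)]
    (T : HomTC k G H) (p q s : G)
    (M : Type*) [AddCommGroup M] [Module k M] (N : Type*) [AddCommGroup N] [Module k N]
    (μ : M ≃ₗ[k] M) (actM : H p →ₗ[k] M →ₗ[k] M) (ρM : ∀ r : G, M →ₗ[k] M ⊗[k] H r)
    (ν : N ≃ₗ[k] N) (actN : H q →ₗ[k] N →ₗ[k] N) (ρN : ∀ r : G, N →ₗ[k] N ⊗[k] H r)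
    (hM : IsYD k T p μ actM ρM) (hN : IsYD k T q ν actN ρN) :
    ∀ (m : M) (n : N),
      braid k T (s * q * s⁻¹) μ (cCoact k T s ρM) (cAct k T s q actN) ν (m ⊗ₜ[k] n)
        = braid k T q μ ρM actN ν (m ⊗ₜ[k] n) := by
  intro m n
  have hinv : (q⁻¹ : G) = s⁻¹ * (s * q * s⁻¹)⁻¹ * s := by group
  have hdeg : s * q⁻¹ * s⁻¹ = (s * q * s⁻¹)⁻¹ := by group
  have hact : ∀ h : H q⁻¹,
      T.crossOf s⁻¹ (s * q * s⁻¹) q (by group)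
        (T.antipodeOf (s * q * s⁻¹)⁻¹ (s * q * s⁻¹) (inv_inv _)
          (T.crossOf s q⁻¹ (s * q * s⁻¹)⁻¹ hdeg h))
      = T.antipodeOf q⁻¹ q (inv_inv q) h := by
    intro h
    rw [T.antipodeOf_crossOf (inv_inv q) (inv_inv _) hdeg rfl,
      T.crossOf_inv_crossOf (inv_mul_cancel s)]
  simp only [braid, cAct, T.cCoact_eq hinv hdeg, LinearMap.comp_apply, TensorProduct.map_tmul]
  congr 1
  induction ρM q⁻¹ m with
  | zero => simp
  | add x y hx hy => simp only [map_add, TensorProduct.add_tmul, hx, hy]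
  | tmul x y =>
    exact congrArg (fun h => μ x ⊗ₜ[k] actN h (ν.symm n)) (hact y)
end
end
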